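/- The coefficient in the Pfaffian Pf(B⁽ⁱʲ⁾)_{1≤i<j≤2μ} of a 2μ-linear monomial ρ = z⁽ⁱ⁰¹⁾⋯z⁽ⁱ⁰ᵐ⁰⁾ ∗₁⁽ⁱ¹¹⁾⋯∗_ν⁽ⁱ^{νm_ν}⁾ (with ascending superscripts within each letter group, ∗ standing for x or y) is zero unless each m_r is even and, for r ≥ 1, the letters x_r and y_r occur in alternating order; in that case the coefficient equals 2^{μ − #{r ≥ 1 : m_r ≥ 1}} · sgn(ρ), where sgn(ρ) is the sign of the permutation of {1,…,2μ} obtained by reading off the superscripts group by group. -/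

import Mathlib

open MvPolynomial

/-- Permutations giving a canonical perfect matching: σ(2i) < σ(2i+1) and σ(2i) increasing. -/
def pfPerms (μ : ℕ) : Finset (Equiv.Perm (Fin (2*μ))) :=
  Finset.univ.filter fun σ =>
    (∀ i : Fin μ, σ ⟨2*i.1, by have := i.2; omega⟩ < σ ⟨2*i.1+1, by have := i.2; omega⟩) ∧
    (∀ i j : Fin μ, i < j →
      σ ⟨2*i.1, by have := i.2; omega⟩ < σ ⟨2*j.1, by have := j.2; omega⟩)


/-- The Pfaffian of a `2μ × 2μ` matrix (intended for skew-symmetric matrices). -/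
def pfaffian {R : Type*} [CommRing R] {μ : ℕ} (A : Matrix (Fin (2*μ)) (Fin (2*μ)) R) : R :=
  ∑ σ ∈ pfPerms μ, (Equiv.Perm.sign σ : ℤ) •
    ∏ i : Fin μ, A (σ ⟨2*i.1, by have := i.2; omega⟩) (σ ⟨2*i.1+1, by have := i.2; omega⟩)


/-- The exponent vector of the `m`-linear monomial in which vector `i` contributes
its coordinate `c i`. -/
noncomputable def expOf {m n : ℕ} (c : Fin m → Fin n) : (Fin m × Fin n) →₀ ℕ :=
  ∑ i : Fin m, Finsupp.single (i, c i) 1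


/-- The number `m_r` of occurrences of letters from group `r` (the pair `x_r, y_r`,
coordinates `2r, 2r+1`; for `n` odd, group `n/2` is the letter `z`). -/
def cnt {m n : ℕ} (c : Fin m → Fin n) (r : ℕ) : ℕ :=
  (Finset.univ.filter fun i : Fin m => (c i).1 / 2 = r).card


/-- In the monomial encoded by `c`, the letters `x_r` (coordinate `2r`) and `y_r`
(coordinate `2r+1`) occur in alternating order. -/
def Alt {m n : ℕ} (c : Fin m → Fin n) (r : ℕ) : Prop :=
  ∀ i j : Fin m, i < j → (c i).1 / 2 = r → (c j).1 / 2 = r →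
    (∀ l : Fin m, i < l → l < j → (c l).1 / 2 ≠ r) → c i ≠ c j


/-- Ordering key for group-by-group reading: the `z` group (group `n/2`, present for odd `n`)
comes first, then the pair groups in order. -/
def grpKey {m n : ℕ} (c : Fin m → Fin n) (i : Fin m) : ℕ :=
  if (c i).1 / 2 = n / 2 then 0 else (c i).1 / 2 + 1


/-- `sgn ρ`: the sign of the permutation obtained by reading off the superscripts of the
monomial group by group (z's first, then each pair group in increasing superscript order),
computed as `(-1)^(number of inversions)`. -/
def sgnMon {m n : ℕ} (c : Fin m → Fin n) : ℤ :=
  (-1) ^ (Finset.univ.filter fun p : Fin m × Fin m =>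
      p.1 < p.2 ∧ grpKey c p.2 < grpKey c p.1).card


/-- The polarized scalar product `B⁽ⁱʲ⁾` of the generic vectors `v⁽ⁱ⁾` and `v⁽ʲ⁾`. -/
noncomputable def Bpoly (n m : ℕ) (i j : Fin m) : MvPolynomial (Fin m × Fin n) ℤ :=
  (∑ r : Fin (n/2),
      (X (i, ⟨2*r.1, by have := r.2; omega⟩) * X (j, ⟨2*r.1+1, by have := r.2; omega⟩)
       + X (i, ⟨2*r.1+1, by have := r.2; omega⟩) * X (j, ⟨2*r.1, by have := r.2; omega⟩)))
  + if h : n % 2 = 1 then 2 * X (i, ⟨n-1, by omega⟩) * X (j, ⟨n-1, by omega⟩) else 0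


/-- The `2μ × 2μ` skew-symmetric matrix of the `B⁽ⁱʲ⁾`. -/
noncomputable def Bmat (n μ : ℕ) :
    Matrix (Fin (2*μ)) (Fin (2*μ)) (MvPolynomial (Fin (2*μ) × Fin n) ℤ) :=
  fun i j => if i < j then Bpoly n (2*μ) i j else if j < i then -(Bpoly n (2*μ) j i) else 0



section grp
variable {α : Type*} [LinearOrder α]

def AltS (x : α → ℕ) (T : Finset α) : Prop :=
  ∀ a ∈ T, ∀ b ∈ T, a < b → (∀ l ∈ T, a < l → ¬ l < b) → x a ≠ x b

/-- number of elements of `T` below `j`, as a sign -/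
def rk (T : Finset α) (j : α) : ℤ := ∏ l ∈ T, if l < j then -1 else 1

lemma rk_eq (T : Finset α) (j : α) : rk T j = (-1) ^ (T.filter (· < j)).card := by
  rw [rk, Finset.prod_ite]; simp

lemma rk_sum (T : Finset α) : ∑ j ∈ T, rk T j = if Odd T.card then 1 else 0 := by
  induction T using Finset.induction_on_max with
  | empty => simp
  | insert a s h ih =>
    have ha : a ∉ s := fun h' => lt_irrefl _ (h a h')
    rw [Finset.sum_insert ha, Finset.card_insert_of_notMem ha]
    have h1 : ∑ j ∈ s, rk (insert a s) j = ∑ j ∈ s, rk s j := by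
      refine Finset.sum_congr rfl fun j hj => ?_
      rw [rk, Finset.prod_insert ha, if_neg (h j hj).not_gt, one_mul, rk]
    have h2 : rk (insert a s) a = (-1) ^ s.card := by
      rw [rk, Finset.prod_insert ha, if_neg (lt_irrefl _), one_mul,
        Finset.prod_congr rfl (fun l hl => if_pos (h l hl))]
      simp
    rw [h1, h2, ih]
    rcases Nat.even_or_odd s.card with h | h
    · simp [h.neg_one_pow, h.add_one, Nat.not_odd_iff_even.mpr h]
    · simp [h.neg_one_pow, h, Nat.not_odd_iff_even.mpr h.add_one]

open Classical in
noncomputable def fz (G : Finset α) : ℤ := if Even G.card then 2 ^ (G.card / 2) else 0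

open Classical in
noncomputable def fp (x : α → ℕ) (G : Finset α) : ℤ :=
  if G = ∅ then 1 else if Even G.card ∧ AltS x G then 2 ^ (G.card / 2 - 1) else 0

lemma fz_rec (i : α) (T : Finset α) (h : ∀ l ∈ T, i < l) :
    fz (insert i T) = ∑ j ∈ T, rk T j * 2 * fz (T.erase j) := by
  have hi : i ∉ T := fun h' => lt_irrefl _ (h i h')
  have h1 : ∑ j ∈ T, rk T j * 2 * fz (T.erase j) =
      (∑ j ∈ T, rk T j) * (2 * if Even (T.card - 1) then 2 ^ ((T.card - 1) / 2) else 0) := by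
    rw [Finset.sum_mul]
    refine Finset.sum_congr rfl fun j hj => ?_
    rw [fz, Finset.card_erase_of_mem hj]; ring
  rw [h1, rk_sum, fz, Finset.card_insert_of_notMem hi]
  rcases Nat.even_or_odd T.card with h | h
  · simp [Nat.not_even_iff_odd.mpr h.add_one, Nat.not_odd_iff_even.mpr h]
  · obtain ⟨k, hk⟩ := h
    have : (2 * k + 1 + 1) / 2 = k + 1 := by omega
    simp [hk, this, Nat.even_add_one, pow_succ]; ring

lemma AltS.parity (x : α → ℕ) (hx : ∀ a, x a < 2) (T : Finset α) :
    AltS x T → ∀ a ∈ T, ∀ b ∈ T, (∀ l ∈ T, a ≤ l) → (∀ l ∈ T, l ≤ b) →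
      (x a = x b ↔ Odd T.card) := by
  induction T using Finset.induction_on_max with
  | empty => simp
  | insert m s h ih =>
    intro hA a ha b hb hmin hmax
    have hm : m ∉ s := fun h' => lt_irrefl _ (h m h')
    have hbm : b = m := by
      rcases Finset.mem_insert.mp hb with h' | h'
      · exact h'
      · exact absurd (h b h') (hmax m (Finset.mem_insert_self _ _)).not_gt
    subst hbm
    rw [Finset.card_insert_of_notMem hm]
    rcases s.eq_empty_or_nonempty with rfl | hs
    · simp at ha; simp [ha]
    · have has : a ∈ s := by
        rcases Finset.mem_insert.mp ha with h' | h'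
        · obtain ⟨t, ht⟩ := hs
          exact absurd (h t ht) (h' ▸ (hmin t (Finset.mem_insert_of_mem ht))).not_gt
        · exact h'
      have hA' : AltS x s := by
        intro u hu v hv huv hl
        refine hA u (Finset.mem_insert_of_mem hu) v (Finset.mem_insert_of_mem hv) huv ?_
        intro l hl' h1 h2
        rcases Finset.mem_insert.mp hl' with h' | h'
        · subst h'; exact lt_asymm h2 (h v hv)
        · exact hl l h' h1 h2
      have hmx := s.max'_mem hs
      have := ih hA' a has _ hmx (fun l hl => hmin l (Finset.mem_insert_of_mem hl))
        (fun l hl => s.le_max' l hl)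
      have h3 : x (s.max' hs) ≠ x b := by
        refine hA _ (Finset.mem_insert_of_mem hmx) b hb (h _ hmx) ?_
        intro l hl h1 h2
        rcases Finset.mem_insert.mp hl with h' | h'
        · subst h'; exact lt_irrefl _ h2
        · exact absurd h1 (s.le_max' l h').not_gt
      have e1 := hx a
      have e2 := hx b
      have e3 := hx (s.max' hs)
      rw [Nat.odd_add_one, ← this]
      omega

lemma AltS.of_insert {x : α → ℕ} {i : α} {T : Finset α} (h : ∀ l ∈ T, i < l)
    (hA : AltS x (insert i T)) : AltS x T := by
  intro u hu v hv huv hl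
  refine hA u (Finset.mem_insert_of_mem hu) v (Finset.mem_insert_of_mem hv) huv ?_
  intro l hl' h1 h2
  rcases Finset.mem_insert.mp hl' with h' | h'
  · subst h'; exact lt_asymm h1 (h u hu)
  · exact hl l h' h1 h2

lemma AltS.swap {x : α → ℕ} {T : Finset α} {s s' : α} (hs : s ∈ T) (hs' : s' ∈ T) (hlt : s < s')
    (hadj : ∀ l ∈ T, s < l → ¬ l < s') (hx : x s = x s') :
    AltS x (T.erase s) ↔ AltS x (T.erase s') := by
  constructor
  · intro hA a ha b hb hab hl
    simp only [Finset.mem_erase] at *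
    by_cases h1 : a = s
    · subst h1
      rw [hx]
      have : s' < b := lt_of_le_of_ne (not_lt.mp (hadj b hb.2 hab)) (Ne.symm hb.1)
      refine hA s' (by simp [hs', hlt.ne']) b (by simp [hb.2, hab.ne']) this ?_
      intro l hl1 h2 h3
      simp only [Finset.mem_erase] at hl1
      exact hl l ⟨h2.ne', hl1.2⟩ (hlt.trans h2) h3
    · by_cases h2 : b = s
      · subst h2
        rw [hx]
        refine hA a (by simp [h1, ha]) s' (by simp [hs', hlt.ne']) (hab.trans hlt) ?_
        intro l hl1 h2 h3
        simp only [Finset.mem_erase] at hl1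
        rcases lt_or_gt_of_ne hl1.1 with h4 | h4
        · exact hl l ⟨h3.ne, hl1.2⟩ h2 h4
        · exact hadj l hl1.2 h4 h3
      · refine hA a (by simp [h1, ha]) b (by simp [h2, hb]) hab ?_
        intro l hl1 h3 h4
        simp only [Finset.mem_erase] at hl1
        by_cases h5 : l = s'
        · subst h5
          have : a < s := lt_of_le_of_ne (not_lt.mp fun h6 => hadj a ha.2 h6 h3) h1
          exact hl s ⟨hlt.ne, hs⟩ this (hlt.trans h4)
        · exact hl l ⟨h5, hl1.2⟩ h3 h4
  · intro hA a ha b hb hab hl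
    simp only [Finset.mem_erase] at *
    by_cases h1 : a = s'
    · subst h1
      rw [← hx]
      refine hA s (by simp [hs, hlt.ne]) b (by simp [hb.2, hab.ne']) (hlt.trans hab) ?_
      intro l hl1 h2 h3
      simp only [Finset.mem_erase] at hl1
      rcases lt_or_gt_of_ne hl1.1 with h4 | h4
      · exact hadj l hl1.2 h2 h4
      · exact hl l ⟨h2.ne', hl1.2⟩ h4 h3
    · by_cases h2 : b = s'
      · subst h2
        rw [← hx]
        have : a < s := lt_of_le_of_ne (not_lt.mp fun h6 => hadj a ha.2 h6 hab) ha.1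
        refine hA a (by simp [h1, ha]) s (by simp [hs, hlt.ne]) this ?_
        intro l hl1 h2 h3
        simp only [Finset.mem_erase] at hl1
        exact hl l ⟨h3.ne, hl1.2⟩ h2 (h3.trans hlt)
      · refine hA a (by simp [h1, ha]) b (by simp [h2, hb]) hab ?_
        intro l hl1 h3 h4
        simp only [Finset.mem_erase] at hl1
        by_cases h5 : l = s
        · subst h5
          have : s' < b := lt_of_le_of_ne (not_lt.mp fun h6 => hadj b hb.2 h4 h6) (Ne.symm h2)
          exact hl s' ⟨hlt.ne', hs'⟩ (h3.trans hlt) this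
        · exact hl l ⟨h5, hl1.2⟩ h3 h4

lemma AltS.interior {x : α → ℕ} (hx : ∀ a, x a < 2) {T : Finset α} {a j b : α} (ha : a ∈ T)
    (hj : j ∈ T) (hb : b ∈ T) (h1 : a < j) (h2 : j < b) (hA : AltS x T) :
    ¬ AltS x (T.erase j) := by
  intro hA'
  have n1 : (T.filter (· < j)).Nonempty := ⟨a, by simp [ha, h1]⟩
  have n2 : (T.filter (j < ·)).Nonempty := ⟨b, by simp [hb, h2]⟩
  have m1 := Finset.max'_mem _ n1
  have m2 := Finset.min'_mem _ n2
  have M1 := fun l hl => Finset.le_max' (T.filter (· < j)) l hl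
  have M2 := fun l hl => Finset.min'_le (T.filter (j < ·)) l hl
  set p := (T.filter (· < j)).max' n1
  set q := (T.filter (j < ·)).min' n2
  simp only [Finset.mem_filter] at m1 m2 M1 M2
  have e1 : x p ≠ x j := hA p m1.1 j hj m1.2 fun l hl h3 h4 => (M1 l ⟨hl, h4⟩).not_gt h3
  have e2 : x j ≠ x q := hA j hj q m2.1 m2.2 fun l hl h3 h4 => (M2 l ⟨hl, h3⟩).not_gt h4
  have e3 : x p ≠ x q := by
    refine hA' p (by simp [m1.1, m1.2.ne]) q (by simp [m2.1, m2.2.ne']) (m1.2.trans m2.2) ?_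
    intro l hl h3 h4
    simp only [Finset.mem_erase] at hl
    rcases lt_or_gt_of_ne hl.1 with h5 | h5
    · exact (M1 l ⟨hl.2, h5⟩).not_gt h3
    · exact (M2 l ⟨hl.2, h5⟩).not_gt h4
  have := hx p
  have := hx q
  have := hx j
  omega

lemma AltS.insert_iff {x : α → ℕ} {i a : α} {T : Finset α} (h : ∀ l ∈ T, i < l) (ha : a ∈ T)
    (hmin : ∀ l ∈ T, a ≤ l) (hA : AltS x T) : AltS x (insert i T) ↔ x i ≠ x a := by
  constructor
  · intro h'
    refine h' i (Finset.mem_insert_self _ _) a (Finset.mem_insert_of_mem ha) (h a ha) ?_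
    intro l hl h1 h2
    rcases Finset.mem_insert.mp hl with h' | h'
    · exact h1.ne' h'
    · exact (hmin l h').not_gt h2
  · intro hne u hu v hv huv hl
    rcases Finset.mem_insert.mp hv with rfl | hv'
    · rcases Finset.mem_insert.mp hu with rfl | hu'
      · exact absurd huv (lt_irrefl _)
      · exact absurd huv (h u hu').not_gt
    rcases Finset.mem_insert.mp hu with rfl | hu'
    · have : v = a := by
        rcases (hmin v hv').lt_or_eq with h' | h'
        · exact absurd h' (hl a (Finset.mem_insert_of_mem ha) (h a ha))
        · exact h'.symm
      rw [this]; exact hne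
    · exact hA u hu' v hv' huv fun l hl' => hl l (Finset.mem_insert_of_mem hl')

lemma fp_odd (x : α → ℕ) (G : Finset α) (h : Odd G.card) : fp x G = 0 := by
  rw [fp, if_neg, if_neg]
  · exact fun h' => Nat.not_even_iff_odd.mpr h h'.1
  · rintro rfl; simp at h

lemma fp_not (x : α → ℕ) (G : Finset α) (hG : G.Nonempty) (h : ¬ AltS x G) : fp x G = 0 := by
  rw [fp, if_neg hG.ne_empty, if_neg]
  exact fun h' => h h'.2

lemma fp_rec (x : α → ℕ) (hx : ∀ a, x a < 2) (i : α) (T : Finset α) (h : ∀ l ∈ T, i < l) :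
    fp x (insert i T) = ∑ j ∈ T, rk T j * (if x i = x j then 0 else 1) * fp x (T.erase j) := by
  have hi : i ∉ T := fun h' => lt_irrefl _ (h i h')
  rcases Nat.even_or_odd T.card with hT | hT
  · rw [fp_odd _ _ (by rw [Finset.card_insert_of_notMem hi]; exact hT.add_one)]
    symm
    refine Finset.sum_eq_zero fun j hj => ?_
    rw [fp_odd, mul_zero]
    rw [Finset.card_erase_of_mem hj]
    have : 0 < T.card := Finset.card_pos.mpr ⟨j, hj⟩
    obtain ⟨k, hk⟩ := hT
    exact ⟨k - 1, by omega⟩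
  by_cases hA : AltS x T
  · have hne : T.Nonempty := by
      rw [← Finset.card_pos]; obtain ⟨k, hk⟩ := hT; omega
    have m1 := T.min'_mem hne
    have m2 := T.max'_mem hne
    have M1 := fun l hl => Finset.min'_le T l hl
    have M2 := fun l hl => Finset.le_max' T l hl
    set a := T.min' hne
    set b := T.max' hne
    have hab : x a = x b := (AltS.parity x hx T hA a m1 b m2 M1 M2).mpr hT
    have hL : fp x (insert i T) = if x i = x a then 0 else 2 ^ (T.card / 2) := by
      rw [fp, if_neg (Finset.insert_ne_empty _ _), AltS.insert_iff h m1 M1 hA,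
        Finset.card_insert_of_notMem hi]
      obtain ⟨k, hk⟩ := hT
      have e1 : (2 * k + 1 + 1) / 2 - 1 = k := by omega
      have e2 : (2 * k + 1) / 2 = k := by omega
      by_cases h' : x i = x a
      · simp [h']
      · simp [h', hk, e1, e2, Nat.even_add_one]
    have hra : rk T a = 1 := by
      rw [rk]; exact Finset.prod_eq_one fun l hl => if_neg (M1 l hl).not_gt
    by_cases hc : T.card = 1
    · obtain ⟨t, ht⟩ := Finset.card_eq_one.mp hc
      have : a = t := by simpa [ht] using m1
      rw [hL, hc]
      rw [this] at hra ⊢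
      rw [ht] at hra ⊢
      simp [hra, fp]
    have hc3 : 3 ≤ T.card := by obtain ⟨k, hk⟩ := hT; omega
    have hab' : a < b := by
      refine lt_of_le_of_ne (M1 b m2) fun e => ?_
      have : T ⊆ {a} := fun l hl => by
        simp only [Finset.mem_singleton]
        exact le_antisymm (e ▸ M2 l hl) (M1 l hl)
      have := Finset.card_le_card this
      simp at this; omega
    have hrb : rk T b = 1 := by
      rw [rk, ← Finset.mul_prod_erase T _ m2, if_neg (lt_irrefl _), one_mul,
        Finset.prod_congr rfl (g := fun _ => (-1 : ℤ))]
      · rw [Finset.prod_const, Finset.card_erase_of_mem m2]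
        obtain ⟨k, hk⟩ := hT
        exact Even.neg_one_pow ⟨k, by omega⟩
      · intro l hl
        rw [Finset.mem_erase] at hl
        exact if_pos (lt_of_le_of_ne (M2 l hl.2) hl.1)
    have hE : ∀ t ∈ T, AltS x (T.erase t) → fp x (T.erase t) = 2 ^ (T.card / 2 - 1) := by
      intro t ht hAt
      have hcard := Finset.card_erase_of_mem ht
      obtain ⟨k, hk⟩ := hT
      rw [fp, if_neg, if_pos ⟨⟨k, by omega⟩, hAt⟩, hcard]
      · congr 1; omega
      · intro h0; rw [h0] at hcard; simp at hcard; omega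
    have hEa : AltS x (T.erase a) := by
      have : insert a (T.erase a) = T := Finset.insert_erase m1
      refine AltS.of_insert (i := a) ?_ (by rw [this]; exact hA)
      intro l hl
      rw [Finset.mem_erase] at hl
      exact lt_of_le_of_ne (M1 l hl.2) (Ne.symm hl.1)
    have hEb : AltS x (T.erase b) := by
      intro u hu v hv huv hl
      rw [Finset.mem_erase] at hu hv
      refine hA u hu.2 v hv.2 huv fun l hl' h1 h2 => hl l ?_ h1 h2
      rw [Finset.mem_erase]
      refine ⟨?_, hl'⟩
      rintro rfl
      exact (M2 v hv.2).not_gt h2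
    rw [← Finset.sum_subset (s₁ := {a, b})]
    · rw [Finset.sum_pair hab'.ne, hra, hrb, hE a m1 hEa, hE b m2 hEb, hL, ← hab]
      have : T.card / 2 = (T.card / 2 - 1) + 1 := by omega
      split_ifs
      · simp
      · rw [this, pow_succ]; simp; ring
    · intro t ht
      simp only [Finset.mem_insert, Finset.mem_singleton] at ht
      rcases ht with rfl | rfl <;> assumption
    · intro t ht ht'
      simp only [Finset.mem_insert, Finset.mem_singleton, not_or] at ht'
      rw [fp_not, mul_zero]
      · exact ⟨a, by simp [m1, Ne.symm ht'.1]⟩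
      · exact AltS.interior hx m1 ht m2 (lt_of_le_of_ne (M1 t ht) (Ne.symm ht'.1))
          (lt_of_le_of_ne (M2 t ht) ht'.2) hA
  · rw [fp_not _ _ (Finset.insert_nonempty _ _) (fun h' => hA (AltS.of_insert h h'))]
    have hA0 := hA
    unfold AltS at hA0
    push Not at hA0
    obtain ⟨s, hs, s', hs', hlt, hadj, hxs⟩ := hA0
    symm
    rw [← Finset.sum_subset (s₁ := {s, s'})]
    · rw [Finset.sum_pair hlt.ne]
      have hr : rk T s' = - rk T s := by
        rw [rk, rk, ← Finset.mul_prod_erase T _ hs, ← Finset.mul_prod_erase T _ hs,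
          if_pos hlt, if_neg (lt_irrefl _), neg_one_mul, one_mul]
        congr 1
        refine Finset.prod_congr rfl fun l hl => ?_
        rw [Finset.mem_erase] at hl
        have : l < s' ↔ l < s := by
          refine ⟨fun h1 => ?_, fun h1 => h1.trans hlt⟩
          exact lt_of_le_of_ne (not_lt.mp fun h2 => (hadj l hl.2 h2).not_gt h1) hl.1
        simp [this]
      have hf : fp x (T.erase s') = fp x (T.erase s) := by
        have e := AltS.swap hs hs' hlt (fun l hl h1 => (hadj l hl h1).not_gt) hxs
        have n1 : T.erase s ≠ ∅ := Finset.ne_empty_of_mem (a := s') (by simp [hs', hlt.ne'])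
        have n2 : T.erase s' ≠ ∅ := Finset.ne_empty_of_mem (a := s) (by simp [hs, hlt.ne])
        rw [fp, fp, if_neg n1, if_neg n2, e, Finset.card_erase_of_mem hs,
          Finset.card_erase_of_mem hs']
      rw [hr, hf, hxs]; ring
    · intro t ht
      simp only [Finset.mem_insert, Finset.mem_singleton] at ht
      rcases ht with rfl | rfl <;> assumption
    · intro t ht ht'
      simp only [Finset.mem_insert, Finset.mem_singleton, not_or] at ht'
      rw [fp_not, mul_zero]
      · exact ⟨s, by simp [hs, Ne.symm ht'.1]⟩
      · intro h1
        refine h1 s (by simp [hs, Ne.symm ht'.1]) s' (by simp [hs', Ne.symm ht'.2]) hlt ?_ hxs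
        intro l hl h2
        rw [Finset.mem_erase] at hl
        exact (hadj l hl.2 h2).not_gt

/-- inversion sign -/
def sgnS (g : α → ℕ) (S : Finset α) : ℤ :=
  ∏ a ∈ S, ∏ b ∈ S, if a < b ∧ g b < g a then -1 else 1

lemma sgnS_rec (g : α → ℕ) (i j : α) (T : Finset α) (h : ∀ l ∈ T, i < l) (hj : j ∈ T)
    (hg : g j = g i) :
    sgnS g (insert i T) * rk (T.filter (fun l => g l = g i)) j = rk T j * sgnS g (T.erase j) := by
  have hi : i ∉ T := fun h' => lt_irrefl _ (h i h')
  obtain ⟨T', hT', rfl⟩ : ∃ T', j ∉ T' ∧ T = insert j T' :=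
    ⟨T.erase j, by simp, (Finset.insert_erase hj).symm⟩
  have hi' : i ∉ T' := fun h' => hi (Finset.mem_insert_of_mem h')
  have hij : i < j := h j hj
  rw [Finset.erase_insert hT', sgnS, Finset.prod_insert hi, Finset.prod_insert hT',
    Finset.prod_insert hi, Finset.prod_insert hT', Finset.prod_insert hi, Finset.prod_insert hT']
  have e : ∀ a ∈ T', (∏ b ∈ insert i (insert j T'), if a < b ∧ g b < g a then (-1:ℤ) else 1) =
      (if a < i ∧ g i < g a then -1 else 1) * ((if a < j ∧ g j < g a then -1 else 1) *
        ∏ b ∈ T', if a < b ∧ g b < g a then (-1:ℤ) else 1) := fun a _ => by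
    rw [Finset.prod_insert hi, Finset.prod_insert hT']
  rw [Finset.prod_congr rfl e, Finset.prod_mul_distrib, Finset.prod_mul_distrib, rk, rk,
    Finset.prod_filter, Finset.prod_insert hT', Finset.prod_insert hT', sgnS]
  have key : (∏ b ∈ T', if i < b ∧ g b < g i then (-1:ℤ) else 1) *
      (∏ b ∈ T', if j < b ∧ g b < g j then (-1:ℤ) else 1) *
      (∏ b ∈ T', if b < i ∧ g i < g b then (-1:ℤ) else 1) *
      (∏ b ∈ T', if b < j ∧ g j < g b then (-1:ℤ) else 1) *
      (∏ b ∈ T', if g b = g i then if b < j then (-1:ℤ) else 1 else 1) =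
      ∏ b ∈ T', if b < j then (-1:ℤ) else 1 := by
    rw [← Finset.prod_mul_distrib, ← Finset.prod_mul_distrib, ← Finset.prod_mul_distrib,
      ← Finset.prod_mul_distrib]
    refine Finset.prod_congr rfl fun b hb => ?_
    have h1 : i < b := h b (Finset.mem_insert_of_mem hb)
    have h2 : b ≠ j := fun h' => hT' (h' ▸ hb)
    rw [hg]
    rcases lt_trichotomy (g b) (g i) with h4 | h4 | h4
    · rcases lt_or_gt_of_ne h2 with h3 | h3 <;>
        simp [h1, h1.not_gt, h3, h3.not_gt, h4, h4.not_gt, h4.ne]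
    · rcases lt_or_gt_of_ne h2 with h3 | h3 <;>
        simp [h4]
    · rcases lt_or_gt_of_ne h2 with h3 | h3 <;>
        simp [h1.not_gt, h3, h3.not_gt, h4, h4.not_gt, h4.ne']
  simp only [hg, lt_irrefl, and_false, if_false, one_mul, if_true] at key ⊢
  rw [← key]; ring

variable (g : α → ℕ) (R : Finset ℕ) (f : ℕ → Finset α → ℤ)

def FF (S : Finset α) : ℤ := sgnS g S * ∏ r ∈ R, f r (S.filter (fun l => g l = r))

lemma FF_rec (M : α → α → ℤ) (hR : ∀ a, g a ∈ R) (hM : ∀ a b, g a ≠ g b → M a b = 0)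
    (hf : ∀ (i : α) (T : Finset α), (∀ l ∈ T, i < l) → (∀ l ∈ T, g l = g i) →
      f (g i) (insert i T) = ∑ j ∈ T, rk T j * M i j * f (g i) (T.erase j))
    (i : α) (T : Finset α) (h : ∀ l ∈ T, i < l) :
    FF g R f (insert i T) = ∑ j ∈ T, rk T j * M i j * FF g R f (T.erase j) := by
  have h1 : ∑ j ∈ T, rk T j * M i j * FF g R f (T.erase j) =
      ∑ j ∈ T.filter (fun l => g l = g i), rk T j * M i j * FF g R f (T.erase j) := by
    symm
    refine Finset.sum_subset (Finset.filter_subset _ _) fun j hj hj' => ?_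
    have : g i ≠ g j := fun h' => hj' (by simp [hj, h'])
    rw [hM _ _ this]; simp
  rw [h1, FF, ← Finset.mul_prod_erase R _ (hR i), Finset.filter_insert, if_pos rfl, hf]
  · rw [Finset.sum_mul, Finset.mul_sum]
    refine Finset.sum_congr rfl fun j hj => ?_
    rw [Finset.mem_filter] at hj
    rw [FF, ← Finset.mul_prod_erase R _ (hR i)]
    have e0 := sgnS_rec g i j T h hj.1 hj.2
    have e1 : (T.filter (fun l => g l = g i)).erase j = (T.erase j).filter (fun l => g l = g i) := by
      ext l; simp only [Finset.mem_erase, Finset.mem_filter]; tauto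
    have e2 : ∏ r ∈ R.erase (g i), f r ((insert i T).filter (fun l => g l = r)) =
        ∏ r ∈ R.erase (g i), f r ((T.erase j).filter (fun l => g l = r)) := by
      refine Finset.prod_congr rfl fun r hr => ?_
      rw [Finset.mem_erase] at hr
      congr 1
      ext l
      simp only [Finset.mem_erase, Finset.mem_filter, Finset.mem_insert]
      constructor
      · rintro ⟨rfl | h2, h3⟩
        · exact absurd h3.symm hr.1
        · refine ⟨⟨?_, h2⟩, h3⟩
          rintro rfl
          exact hr.1 (h3.symm.trans hj.2)
      · rintro ⟨⟨_, h2⟩, h3⟩; exact ⟨Or.inr h2, h3⟩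
    rw [e1, e2]
    linear_combination (M i j * f (g i) ((T.erase j).filter (fun l => g l = g i)) *
      ∏ r ∈ R.erase (g i), f r ((T.erase j).filter (fun l => g l = r))) * e0
  · intro l hl; exact h l (Finset.mem_filter.mp hl).1
  · intro l hl; exact (Finset.mem_filter.mp hl).2

end grp

lemma pf_sum {R : Type*} [CommRing R] {μ : ℕ} (A : Matrix (Fin (2*(μ+1))) (Fin (2*(μ+1))) R) :
    pfaffian A = ∑ j : Fin (2*μ+1), (-1 : R) ^ (j : ℕ) * A (0 : Fin (2*μ+1+1)) j.succ *
      pfaffian (Matrix.of fun a b : Fin (2*μ) => A (j.succAbove a).succ (j.succAbove b).succ) := by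
  have mem : ∀ (j : Fin (2*μ+1)) (τ : Equiv.Perm (Fin (2*μ))) (σ : Equiv.Perm (Fin (2*μ+1+1))),
      σ 0 = 0 → σ 1 = j.succ → (∀ k : Fin (2*μ), σ k.succ.succ = (j.succAbove (τ k)).succ) →
      (σ ∈ pfPerms (μ+1) ↔ τ ∈ pfPerms μ) := by
    intro j τ σ h0 h1 h2
    simp only [pfPerms, Finset.mem_filter, Finset.mem_univ, true_and]
    have mono : ∀ a b : Fin (2*μ), σ a.succ.succ < σ b.succ.succ ↔ τ a < τ b := by
      intro a b
      rw [h2, h2, Fin.succ_lt_succ_iff, Fin.succAbove_lt_succAbove_iff]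
    constructor
    · rintro ⟨H1, H2⟩
      refine ⟨fun i => ?_, fun i k hik => ?_⟩
      · rw [← mono]; exact H1 i.succ
      · rw [← mono]; exact H2 i.succ k.succ (Fin.succ_lt_succ_iff.mpr hik)
    · rintro ⟨H1, H2⟩
      refine ⟨fun i => ?_, fun i k hik => ?_⟩
      · refine Fin.cases ?_ (fun i => ?_) i
        · change σ 0 < σ 1
          rw [h0, h1]; exact Fin.succ_pos _
        · exact (mono ⟨2*i.1, by omega⟩ ⟨2*i.1+1, by omega⟩).mpr (H1 i)
      · induction k using Fin.cases with
        | zero => exact absurd hik (Fin.not_lt_zero _)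
        | succ k =>
          induction i using Fin.cases with
          | zero =>
            change σ 0 < σ (Fin.succ (Fin.succ ⟨2*k.1, by omega⟩))
            rw [h0, h2]; exact Fin.succ_pos _
          | succ i =>
            exact (mono ⟨2*i.1, by omega⟩ ⟨2*k.1, by omega⟩).mpr
              (H2 i k (Fin.succ_lt_succ_iff.mp hik))
  let mk : Fin (2*μ+1) × Equiv.Perm (Fin (2*μ)) → Equiv.Perm (Fin (2*μ+1+1)) := fun p =>
    Equiv.Perm.decomposeFin.symm (0, p.1.cycleRange.symm * Equiv.Perm.decomposeFin.symm (0, p.2))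
  have mk0 : ∀ p, mk p 0 = 0 := fun p => by simp [mk]
  have mks : ∀ p k, mk p (Fin.succ k) =
      ((p.1.cycleRange.symm * Equiv.Perm.decomposeFin.symm (0, p.2)) k).succ := fun p k => by
    simp [mk, Equiv.Perm.decomposeFin_symm_apply_succ]
  have mk1 : ∀ p, mk p 1 = p.1.succ := fun p => by
    rw [← Fin.succ_zero_eq_one, mks]; simp
  have mk2 : ∀ p k, mk p (Fin.succ (Fin.succ k)) = (p.1.succAbove (p.2 k)).succ := fun p k => by
    rw [mks, Equiv.Perm.mul_apply, Equiv.Perm.decomposeFin_symm_apply_succ]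
    simp [Fin.cycleRange_symm_succ]
  have mksign : ∀ p, (Equiv.Perm.sign (mk p) : ℤ) = (-1) ^ (p.1 : ℕ) * Equiv.Perm.sign p.2 := by
    intro p
    simp [mk, Equiv.Perm.decomposeFin.symm_sign, Fin.sign_cycleRange]
  have hR : ∑ j : Fin (2*μ+1), (-1 : R) ^ (j : ℕ) * A (0 : Fin (2*μ+1+1)) j.succ *
      pfaffian (Matrix.of fun a b : Fin (2*μ) => A (j.succAbove a).succ (j.succAbove b).succ) =
      ∑ p ∈ (Finset.univ : Finset (Fin (2*μ+1))) ×ˢ pfPerms μ,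
        (-1 : R) ^ (p.1 : ℕ) * A (0 : Fin (2*μ+1+1)) p.1.succ * ((Equiv.Perm.sign p.2 : ℤ) •
          ∏ i : Fin μ, A (p.1.succAbove (p.2 ⟨2*i.1, by have := i.2; omega⟩)).succ
            (p.1.succAbove (p.2 ⟨2*i.1+1, by have := i.2; omega⟩)).succ) := by
    rw [Finset.sum_product]
    refine Finset.sum_congr rfl fun j _ => ?_
    rw [pfaffian, Finset.mul_sum]
    simp only [Matrix.of_apply]
  rw [hR, pfaffian]
  symm
  refine Finset.sum_bij (fun p _ => mk p) ?_ ?_ ?_ ?_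
  · intro p hp
    exact (mem p.1 p.2 (mk p) (mk0 p) (mk1 p) (mk2 p)).mpr (Finset.mem_product.mp hp).2
  · intro p _ q _ h
    have h1 : p.1 = q.1 := by
      have := congrArg (fun s => s 1) h
      simp only [mk1] at this
      exact Fin.succ_injective _ this
    refine Prod.ext h1 (Equiv.ext fun k => ?_)
    have := congrArg (fun s => s (Fin.succ (Fin.succ k))) h
    simp only [mk2, h1] at this
    exact Fin.succAbove_right_injective (Fin.succ_injective _ this)
  · intro σ hσ
    have hσ' := hσ
    simp only [pfPerms, Finset.mem_filter, Finset.mem_univ, true_and] at hσ'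
    obtain ⟨H1, H2⟩ := hσ'
    have h0 : σ (0 : Fin (2*μ+1+1)) = (0 : Fin (2*μ+1+1)) := by
      obtain ⟨k, hk⟩ := σ.surjective (0 : Fin (2*μ+1+1))
      by_contra hne
      have hpos : (0 : Fin (2*μ+1+1)) < σ (0 : Fin (2*μ+1+1)) := Fin.pos_of_ne_zero hne
      have ev : ∀ i : Fin (μ+1), (0 : Fin (2*μ+1+1)) < σ ⟨2*i.1, by omega⟩ := by
        intro i
        induction i using Fin.cases with
        | zero => exact hpos
        | succ i => exact hpos.trans (H2 0 i.succ (Fin.succ_pos _))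
      have hk2 := k.2
      rcases Nat.even_or_odd' k.1 with ⟨i, hi | hi⟩
      · have := ev ⟨i, by omega⟩
        have e : k = ⟨2*i, by omega⟩ := Fin.ext hi
        rw [e] at hk
        exact this.ne' hk
      · have := (ev ⟨i, by omega⟩).trans (H1 ⟨i, by omega⟩)
        have e : k = ⟨2*i+1, by omega⟩ := Fin.ext hi
        rw [e] at hk
        exact this.ne' hk
    have fix : ∀ {N : ℕ} (s : Equiv.Perm (Fin (N+1))), s 0 = 0 →
        ∃ t, s = Equiv.Perm.decomposeFin.symm (0, t) := by
      intro N s hs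
      obtain ⟨⟨p, t⟩, rfl⟩ := Equiv.Perm.decomposeFin.symm.surjective s
      rw [Equiv.Perm.decomposeFin_symm_apply_zero] at hs
      exact ⟨t, by rw [hs]⟩
    obtain ⟨ρ, hρ⟩ := fix (N := 2*μ+1) σ h0
    obtain ⟨τ, hτ⟩ := fix ((ρ 0).cycleRange * ρ) (by simp)
    have hmk : mk (ρ 0, τ) = σ := by
      rw [hρ]
      simp only [mk]
      rw [← hτ]
      congr 2
      ext k
      simp
    refine ⟨(ρ 0, τ), ?_, hmk⟩
    rw [Finset.mem_product]
    refine ⟨Finset.mem_univ _, ?_⟩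
    exact (mem (ρ 0) τ (mk (ρ 0, τ)) (mk0 _) (mk1 _) (mk2 _)).mp (hmk ▸ hσ)
  · intro p _
    have hp : (∏ i : Fin (μ+1), A (mk p ⟨2*i.1, by have := i.2; omega⟩)
          (mk p ⟨2*i.1+1, by have := i.2; omega⟩)) =
        A (0 : Fin (2*μ+1+1)) p.1.succ *
        ∏ i : Fin μ, A (p.1.succAbove (p.2 ⟨2*i.1, by have := i.2; omega⟩)).succ
            (p.1.succAbove (p.2 ⟨2*i.1+1, by have := i.2; omega⟩)).succ := by
      rw [Fin.prod_univ_succ]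
      congr 1
      · have e0 := mk0 p
        have e1 := mk1 p
        exact congrArg₂ A e0 e1
      · refine Finset.prod_congr rfl fun i _ => ?_
        exact congrArg₂ A (mk2 p ⟨2*i.1, by omega⟩) (mk2 p ⟨2*i.1+1, by omega⟩)
    have hs := mksign p
    refine Eq.trans ?_ (congrArg₂ (fun (a : ℤ) (b : R) => a • b) hs.symm hp.symm)
    simp only [zsmul_eq_mul]
    push_cast
    ring

lemma pf_eq_FF {α : Type*} [LinearOrder α] (M : α → α → ℤ) (F : Finset α → ℤ) (h0 : F ∅ = 1)
    (hF : ∀ (i : α) (T : Finset α), (∀ l ∈ T, i < l) →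
      F (insert i T) = ∑ j ∈ T, rk T j * M i j * F (T.erase j)) (μ : ℕ) :
    ∀ e : Fin (2*μ) → α, StrictMono e →
      pfaffian (Matrix.of fun a b => M (e a) (e b)) = F (Finset.univ.image e) := by
  induction μ with
  | zero =>
    intro e he
    have : (Finset.univ.image e) = ∅ := by
      ext x; simp only [Finset.mem_image, Finset.notMem_empty, iff_false]
      rintro ⟨k, _⟩; exact absurd k.2 (by omega)
    rw [this, h0, pfaffian]
    have : pfPerms 0 = {1} := by decide
    rw [this]; simp
  | succ μ ih =>
    intro e he
    rw [pf_sum]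
    simp only [Matrix.of_apply]
    have e' : StrictMono (fun k : Fin (2*μ+1) => e (Fin.succ k)) :=
      fun a b hab => he (Fin.succ_lt_succ_iff.mpr hab)
    have hS : (Finset.univ.image e) = insert (e (0 : Fin (2*μ+1+1)))
        (Finset.univ.image (fun k : Fin (2*μ+1) => e (Fin.succ k))) := by
      ext x
      simp only [Finset.mem_image, Finset.mem_insert, Finset.mem_univ, true_and]
      constructor
      · rintro ⟨k, rfl⟩
        revert k
        refine Fin.cases (n := 2*μ+1) ?_ ?_
        · left; rfl
        · intro k; right; exact ⟨k, rfl⟩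
      · rintro (rfl | ⟨k, rfl⟩)
        · exact ⟨_, rfl⟩
        · exact ⟨_, rfl⟩
    rw [hS, hF, Finset.sum_image (fun a _ b _ h => e'.injective h)]
    · refine Finset.sum_congr rfl fun j _ => ?_
      rw [ih (fun a => e (j.succAbove a).succ) (fun a b hab => e' (by simpa using hab))]
      have h1 : Finset.univ.image (fun a => e (j.succAbove a).succ) =
          (Finset.univ.image (fun k : Fin (2*μ+1) => e (Fin.succ k))).erase (e j.succ) := by
        ext x
        simp only [Finset.mem_image, Finset.mem_erase, Finset.mem_univ, true_and]
        constructor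
        · rintro ⟨k, rfl⟩
          exact ⟨fun h => Fin.succAbove_ne j k (e'.injective h), _, rfl⟩
        · rintro ⟨h, k, rfl⟩
          have : k ≠ j := fun h' => h (by rw [h'])
          obtain ⟨l, rfl⟩ := Fin.exists_succAbove_eq this
          exact ⟨l, rfl⟩
      have h2 : rk (Finset.univ.image (fun k : Fin (2*μ+1) => e (Fin.succ k))) (e j.succ) =
          (-1) ^ (j : ℕ) := by
        rw [rk, Finset.prod_image (fun a _ b _ h => e'.injective h)]
        have : ∀ k : Fin (2*μ+1), e (Fin.succ k) < e (Fin.succ j) ↔ k < j := fun k =>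
          e'.lt_iff_lt
        simp only [this]
        have hI : (Finset.univ.filter fun k => k < j) = Finset.Iio j := by ext k; simp
        rw [Finset.prod_ite, hI]
        simp
      rw [h1, h2]
    · intro l hl
      simp only [Finset.mem_image, Finset.mem_univ, true_and] at hl
      obtain ⟨k, rfl⟩ := hl
      exact he (Fin.succ_pos _)

/-- scalar weight -/
def wt (n : ℕ) (a b : Fin n) : ℤ :=
  if a.1 / 2 = b.1 / 2 then (if a.1 / 2 = n / 2 then 2 else if a = b then 0 else 1) else 0

lemma eval_Bpoly {n m : ℕ} (c : Fin m → Fin n) (i j : Fin m) :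
    eval (fun p : Fin m × Fin n => if p.2 = c p.1 then (1:ℤ) else 0) (Bpoly n m i j) =
      wt n (c i) (c j) := by
  have hi := (c i).2
  have hj := (c j).2
  rw [Bpoly, map_add, map_sum]
  simp only [map_add, map_mul, eval_X, Fin.ext_iff]
  have hz : eval (fun p : Fin m × Fin n => if p.2 = c p.1 then (1:ℤ) else 0)
      (if h : n % 2 = 1 then 2 * X (i, ⟨n-1, by omega⟩) * X (j, ⟨n-1, by omega⟩) else 0) =
      if (c i).1 / 2 = n / 2 ∧ (c j).1 / 2 = n / 2 then 2 else 0 := by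
    by_cases h : n % 2 = 1
    · have e1 : n - 1 = (c i).1 ↔ (c i).1 / 2 = n / 2 := by omega
      have e2 : n - 1 = (c j).1 ↔ (c j).1 / 2 = n / 2 := by omega
      simp only [h, dif_pos, map_mul, eval_X, Fin.ext_iff, e1, e2, map_ofNat]
      split_ifs <;> simp_all
    · rw [dif_neg h, map_zero, if_neg]; omega
  simp only [Fin.ext_iff] at hz
  rw [hz]
  by_cases hlt : (c i).1 / 2 < n / 2
  · rw [Finset.sum_eq_single ⟨(c i).1 / 2, hlt⟩]
    · simp only [wt, Fin.ext_iff]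
      split_ifs <;> omega
    · intro r _ hr
      have : r.1 ≠ (c i).1 / 2 := fun h => hr (Fin.ext h)
      rw [if_neg (show ¬ (2 * r.1 = (c i).1) by omega),
        if_neg (show ¬ (2 * r.1 + 1 = (c i).1) by omega)]
      simp
    · simp
  · rw [Finset.sum_eq_zero]
    · simp only [wt]
      split_ifs <;> omega
    · intro r _
      have := r.2
      rw [if_neg (show ¬ (2 * r.1 = (c i).1) by omega),
        if_neg (show ¬ (2 * r.1 + 1 = (c i).1) by omega)]
      simp

lemma whom_Bpoly (n m : ℕ) (i j : Fin m) :
    IsWeightedHomogeneous (fun p : Fin m × Fin n => (Pi.single p.1 1 : Fin m → ℕ))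
      (Bpoly n m i j) (Pi.single i 1 + Pi.single j 1) := by
  have hX : ∀ a b : Fin n, IsWeightedHomogeneous
      (fun p : Fin m × Fin n => (Pi.single p.1 1 : Fin m → ℕ))
      (X (i, a) * X (j, b) : MvPolynomial (Fin m × Fin n) ℤ) (Pi.single i 1 + Pi.single j 1) :=
    fun a b => (isWeightedHomogeneous_X ℤ _ (i, a)).mul (isWeightedHomogeneous_X ℤ _ (j, b))
  rw [Bpoly]
  refine IsWeightedHomogeneous.add (IsWeightedHomogeneous.sum _ _ _ fun r _ => (hX _ _).add (hX _ _)) ?_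
  split_ifs with h
  · rw [mul_assoc]
    have := (hX ⟨n-1, by omega⟩ ⟨n-1, by omega⟩).C_mul (2:ℤ)
    simpa using this
  · exact isWeightedHomogeneous_zero _ _ _

lemma coeff_eq_eval {n m : ℕ} (c : Fin m → Fin n) (p : MvPolynomial (Fin m × Fin n) ℤ)
    (hp : IsWeightedHomogeneous (fun p : Fin m × Fin n => (Pi.single p.1 1 : Fin m → ℕ)) p
      (fun _ => 1)) :
    coeff (expOf c) p = eval (fun p : Fin m × Fin n => if p.2 = c p.1 then (1:ℤ) else 0) p := by
  have hexp : ∀ i a, expOf c (i, a) = if a = c i then 1 else 0 := by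
    intro i a
    rw [expOf, Finsupp.finsetSum_apply, Finset.sum_eq_single i]
    · simp [Finsupp.single_apply, eq_comm]
    · intro b _ hb; simp [hb]
    · simp
  rw [eval_eq]
  rw [Finset.sum_eq_single (expOf c)]
  · rw [Finset.prod_eq_one, mul_one]
    rintro ⟨i, a⟩ hia
    rw [Finsupp.mem_support_iff, hexp] at hia
    have : a = c i := by by_contra h; simp [h] at hia
    simp [this]
  · intro d hd hne
    have hw := hp (mem_support_iff.mp hd)
    have hsum : ∀ i, ∑ a, d (i, a) = 1 := by
      intro i
      have := congrFun hw i
      rw [Finsupp.weight_apply, Finsupp.sum_fintype _ _ (by simp), Finset.sum_apply,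
        Fintype.sum_prod_type, Finset.sum_eq_single i] at this
      · simpa using this
      · intro b _ hb
        simp [hb.symm]
      · simp
    have : ∃ i a, a ≠ c i ∧ d (i, a) ≠ 0 := by
      by_contra hcon
      push Not at hcon
      refine hne (Finsupp.ext ?_)
      rintro ⟨i, a⟩
      rw [hexp]
      split_ifs with h
      · have := hsum i
        rw [Finset.sum_eq_single (c i)] at this
        · rw [h]; exact this
        · intro b _ hb; exact hcon i b hb
        · simp
      · exact hcon i a h
    obtain ⟨i, a, h1, h2⟩ := this
    rw [Finset.prod_eq_zero (i := (i, a)), mul_zero]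
    · simpa using h2
    · simp [h1, h2]
  · intro h
    rw [notMem_support_iff.mp h, zero_mul]

lemma prod_pairs {M : Type*} [CommMonoid M] (μ : ℕ) (f : Fin (2*μ) → M) :
    ∏ i : Fin μ, (f ⟨2*i.1, by have := i.2; omega⟩ * f ⟨2*i.1+1, by have := i.2; omega⟩) =
      ∏ k, f k := by
  induction μ with
  | zero => simp
  | succ μ ih =>
    rw [Fin.prod_univ_succ]
    have : ∏ k, f k = f (0 : Fin (2*μ+1+1)) * (f (1 : Fin (2*μ+1+1)) *
        ∏ k : Fin (2*μ), f (Fin.succ (Fin.succ k) : Fin (2*μ+1+1))) := by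
      have := Fin.prod_univ_succ (n := 2*μ+1) f
      rw [Fin.prod_univ_succ (n := 2*μ)] at this
      exact this
    rw [this, ← ih, ← mul_assoc]
    rfl

lemma sum_pairs {M : Type*} [AddCommMonoid M] (μ : ℕ) (f : Fin (2*μ) → M) :
    ∑ i : Fin μ, (f ⟨2*i.1, by have := i.2; omega⟩ + f ⟨2*i.1+1, by have := i.2; omega⟩) =
      ∑ k, f k :=
  prod_pairs (M := Multiplicative M) μ f

lemma coeff_pf (n μ : ℕ) (c : Fin (2*μ) → Fin n) :
    coeff (expOf c) (pfaffian (Bmat n μ)) = pfaffian (Matrix.of fun a b => wt n (c a) (c b)) := by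
  have hB : pfaffian (Bmat n μ) = ∑ σ ∈ pfPerms μ, (Equiv.Perm.sign σ : ℤ) •
      ∏ i : Fin μ, Bpoly n (2*μ) (σ ⟨2*i.1, by have := i.2; omega⟩)
        (σ ⟨2*i.1+1, by have := i.2; omega⟩) := by
    rw [pfaffian]
    refine Finset.sum_congr rfl fun σ hσ => ?_
    simp only [pfPerms, Finset.mem_filter, Finset.mem_univ, true_and] at hσ
    congr 1
    refine Finset.prod_congr rfl fun i _ => ?_
    rw [Bmat, if_pos (hσ.1 i)]
  rw [coeff_eq_eval, hB, map_sum, pfaffian]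
  · refine Finset.sum_congr rfl fun σ hσ => ?_
    rw [map_zsmul, map_prod]
    simp only [eval_Bpoly, Matrix.of_apply]
  · rw [hB]
    refine IsWeightedHomogeneous.sum _ _ _ fun σ _ => ?_
    rw [zsmul_eq_mul]
    have h1 := IsWeightedHomogeneous.prod (Finset.univ : Finset (Fin μ)) _ _
      fun i _ => whom_Bpoly n (2*μ) (σ ⟨2*i.1, by have := i.2; omega⟩)
        (σ ⟨2*i.1+1, by have := i.2; omega⟩)
    rw [sum_pairs μ (fun k => (Pi.single (σ k) 1 : Fin (2*μ) → ℕ)),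
      Equiv.sum_comp σ (fun k => (Pi.single k 1 : Fin (2*μ) → ℕ)),
      Finset.univ_sum_single (fun _ => 1)] at h1
    have := h1.C_mul (Equiv.Perm.sign σ : ℤ)
    simpa using this

lemma sgnS_eq {n m : ℕ} (c : Fin m → Fin n) : sgnS (grpKey c) Finset.univ = sgnMon c := by
  rw [sgnS, sgnMon, ← Finset.prod_product', Finset.prod_ite]
  simp

noncomputable def fgrp {n m : ℕ} (c : Fin m → Fin n) (r : ℕ) : Finset (Fin m) → ℤ :=
  if r = 0 then fz else fp (fun i => (c i).1 % 2)

lemma pf_wt (n μ : ℕ) (c : Fin (2*μ) → Fin n) :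
    pfaffian (Matrix.of fun a b => wt n (c a) (c b)) = sgnMon c *
      ∏ r ∈ Finset.range (n/2+1), fgrp c r (Finset.univ.filter fun l => grpKey c l = r) := by
  have h := pf_eq_FF (fun a b => wt n (c a) (c b))
    (FF (grpKey c) (Finset.range (n/2+1)) (fgrp c)) ?_ ?_ μ id strictMono_id
  · rw [Finset.image_id, FF, sgnS_eq] at h
    exact h
  · rw [FF, Finset.prod_eq_one]
    · simp [sgnS]
    · intro r _
      rw [fgrp]
      split_ifs <;> simp [fz, fp]
  · refine FF_rec _ _ _ _ ?_ ?_ ?_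
    · intro a
      have := (c a).2
      rw [Finset.mem_range, grpKey]
      split_ifs <;> omega
    · intro a b hab
      rw [wt, if_neg]
      intro h
      exact hab (by rw [grpKey, grpKey, h])
    · intro i T hT hg
      by_cases h0 : grpKey c i = 0
      · have hw : ∀ j ∈ T, wt n (c i) (c j) = 2 := by
          intro j hj
          have h1 := hg j hj
          rw [h0] at h1
          rw [grpKey] at h0 h1
          have e1 : (c i).1 / 2 = n / 2 := by by_contra h; simp [h] at h0
          have e2 : (c j).1 / 2 = n / 2 := by by_contra h; simp [h] at h1
          rw [wt, if_pos (e1.trans e2.symm), if_pos e1]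
        simp only [fgrp, h0, if_true]
        rw [fz_rec i T hT]
        exact Finset.sum_congr rfl fun j hj => by rw [hw j hj]
      · have hw : ∀ j ∈ T, wt n (c i) (c j) =
            if (c i).1 % 2 = (c j).1 % 2 then 0 else 1 := by
          intro j hj
          have h1 := hg j hj
          have e0 : grpKey c j ≠ 0 := h1 ▸ h0
          have e1 : (c i).1 / 2 ≠ n / 2 := fun h => h0 (by rw [grpKey, if_pos h])
          have e2 : (c j).1 / 2 ≠ n / 2 := fun h => e0 (by rw [grpKey, if_pos h])
          rw [grpKey, grpKey, if_neg e1, if_neg e2] at h1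
          rw [wt, if_pos (by omega), if_neg e1]
          congr 1
          rw [Fin.ext_iff, eq_iff_iff]
          omega
        simp only [fgrp, h0, if_false]
        rw [fp_rec _ (fun a => Nat.mod_lt _ two_pos) i T hT]
        exact Finset.sum_congr rfl fun j hj => by rw [hw j hj]

lemma filter_zero {n m : ℕ} (c : Fin m → Fin n) :
    (Finset.univ.filter fun l => grpKey c l = 0) =
      Finset.univ.filter fun l => (c l).1 / 2 = n / 2 := by
  ext l
  simp only [Finset.mem_filter, Finset.mem_univ, true_and]
  rw [grpKey]
  split_ifs <;> simp_all

lemma filter_succ {n m : ℕ} (c : Fin m → Fin n) (r : ℕ) (hr : r < n / 2) :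
    (Finset.univ.filter fun l => grpKey c l = r + 1) =
      Finset.univ.filter fun l => (c l).1 / 2 = r := by
  ext l
  simp only [Finset.mem_filter, Finset.mem_univ, true_and]
  rw [grpKey]
  by_cases h : (c l).1 / 2 = n / 2
  · rw [if_pos h, h]
    constructor
    · intro h'; exact absurd h'.symm (Nat.succ_ne_zero r)
    · intro h'; exact absurd h' hr.ne'
  · rw [if_neg h]; exact Nat.succ_inj

lemma Alt_iff {n m : ℕ} (c : Fin m → Fin n) (r : ℕ) :
    Alt c r ↔ AltS (fun i => (c i).1 % 2) (Finset.univ.filter fun l => (c l).1 / 2 = r) := by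
  simp only [Alt, AltS, Finset.mem_filter, Finset.mem_univ, true_and]
  constructor
  · intro h a ha b hb hab hl he
    refine h a b hab ha hb (fun l h1 h2 h3 => hl l h3 h1 h2) (Fin.ext ?_)
    omega
  · intro h a b hab ha hb hl he
    exact h a ha b hb hab (fun l h3 h1 h2 => hl l h1 h2 h3) (by rw [he])

lemma sum_cnt {n m : ℕ} (c : Fin m → Fin n) : ∑ r ∈ Finset.range (n/2+1), cnt c r = m := by
  have := Finset.card_eq_sum_card_fiberwise (s := (Finset.univ : Finset (Fin m)))
    (f := fun i => (c i).1 / 2) (t := Finset.range (n/2+1)) (fun i _ => by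
      have := (c i).2
      simp only [Finset.coe_range, Set.mem_Iio]
      omega)
  simpa [cnt] using this.symm

/-- The coefficient in `Pf (B⁽ⁱʲ⁾)` of the `2μ`-linear monomial encoded by `c` (vector `i`
contributing letter `c i`; here `n = 2ν` or `n = 2ν + 1` with `ν = n/2`) is zero unless
each `m_r` is even and, for each pair group `r < ν`, the letters `x_r, y_r` alternate;
in that case it equals `2^(μ − #{r < ν : m_r ≥ 1}) · sgn ρ`. -/
theorem coeff_pfaffian_Bmat (n μ : ℕ) (c : Fin (2*μ) → Fin n) :
    (¬ ((∀ r : ℕ, Even (cnt c r)) ∧ (∀ r < n / 2, Alt c r)) →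
      MvPolynomial.coeff (expOf c) (pfaffian (Bmat n μ)) = 0) ∧
    (((∀ r : ℕ, Even (cnt c r)) ∧ (∀ r < n / 2, Alt c r)) →
      MvPolynomial.coeff (expOf c) (pfaffian (Bmat n μ)) =
        2 ^ (μ - ((Finset.range (n / 2)).filter fun r => 1 ≤ cnt c r).card) * sgnMon c) := by
  rw [coeff_pf, pf_wt, Finset.prod_range_succ']
  rw [filter_zero]
  have hprod : ∏ r ∈ Finset.range (n/2), fgrp c (r+1)
      (Finset.univ.filter fun l => grpKey c l = r + 1) =
      ∏ r ∈ Finset.range (n/2), fp (fun i => (c i).1 % 2)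
        (Finset.univ.filter fun l => (c l).1 / 2 = r) := by
    refine Finset.prod_congr rfl fun r hr => ?_
    rw [filter_succ c r (Finset.mem_range.mp hr), fgrp, if_neg (Nat.succ_ne_zero r)]
  rw [hprod, fgrp, if_pos rfl]
  constructor
  · intro h
    rw [not_and_or] at h
    rcases h with h | h
    · push Not at h
      obtain ⟨r, hr⟩ := h
      rcases lt_trichotomy r (n/2) with h1 | h1 | h1
      · rw [Finset.prod_eq_zero (Finset.mem_range.mpr h1)]
        · simp
        · exact fp_odd _ _ (Nat.not_even_iff_odd.mp hr)
      · subst h1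
        rw [cnt] at hr
        rw [fz, if_neg hr]; simp
      · exfalso
        apply hr
        have : cnt c r = 0 := by
          rw [cnt, Finset.card_eq_zero, Finset.filter_eq_empty_iff]
          intro i _
          have := (c i).2
          omega
        rw [this]; exact Even.zero
    · push Not at h
      obtain ⟨r, h1, hr⟩ := h
      rw [Finset.prod_eq_zero (Finset.mem_range.mpr h1)]
      · simp
      · refine fp_not _ _ ?_ (fun h => hr ((Alt_iff c r).mpr h))
        rw [Finset.nonempty_iff_ne_empty]
        intro h0
        rw [Alt_iff, h0] at hr
        exact hr (by simp [AltS])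
  · rintro ⟨hE, hA⟩
    have h1 : ∀ r ∈ Finset.range (n/2), fp (fun i => (c i).1 % 2)
        (Finset.univ.filter fun l => (c l).1 / 2 = r) =
        2 ^ (cnt c r / 2 - if 1 ≤ cnt c r then 1 else 0) := by
      intro r hr
      rw [fp]
      by_cases h0 : (Finset.univ.filter fun l => (c l).1 / 2 = r) = ∅
      · rw [if_pos h0, cnt, h0]; simp
      · have : 1 ≤ cnt c r := Finset.card_pos.mpr (Finset.nonempty_iff_ne_empty.mpr h0)
        rw [if_neg h0, if_pos ⟨hE r, (Alt_iff c r).mp (hA r (Finset.mem_range.mp hr))⟩,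
          if_pos this]
        rfl
    have h2 : fz (Finset.univ.filter fun l => (c l).1 / 2 = n / 2) =
        2 ^ (cnt c (n/2) / 2) := by
      have := hE (n/2)
      rw [cnt] at this
      rw [fz, if_pos this]; rfl
    rw [Finset.prod_congr rfl h1, Finset.prod_pow_eq_pow_sum, h2, ← pow_add, mul_comm]
    congr 2
    have h3 := sum_cnt c
    rw [Finset.sum_range_succ] at h3
    have h4 : ∑ r ∈ Finset.range (n/2), (cnt c r / 2 - if 1 ≤ cnt c r then 1 else 0) * 2 +
        (∑ r ∈ Finset.range (n/2), if 1 ≤ cnt c r then 1 else 0) * 2 =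
        ∑ r ∈ Finset.range (n/2), cnt c r := by
      rw [Finset.sum_mul, ← Finset.sum_add_distrib]
      refine Finset.sum_congr rfl fun r _ => ?_
      obtain ⟨k, hk⟩ := hE r
      split_ifs <;> omega
    rw [← Finset.sum_mul] at h4
    rw [Finset.card_filter]
    obtain ⟨k, hk⟩ := hE (n/2)
    omega
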